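/- arXiv:math/0607556 — 3 statements merged into one kernel-verified Lean document; each statement's English description precedes it below -/
import Mathlib

section
/- If H is a subgroup of a free group F_n and F is a free factor of F_n, then any conjugate of F that is contained in H is a free factor of H. -/
namespace KuroshFF

universe u

def FFP {G : Type u} [Group G] (F B : Subgroup G) : Prop :=
  F ⊔ B = ⊤ ∧ ∀ (X : Type u) [Group X] (φ : F →* X) (ψ : B →* X), ∃ θ : G →* X,
    (∀ f : F, θ f = φ f) ∧ (∀ b : B, θ b = ψ b)

theorem ffp_of_bij {G : Type u} [Group G] (F B : Subgroup G)
    (h : Function.Bijective (Monoid.Coprod.lift F.subtype B.subtype)) : FFP F B := by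
  constructor
  · have := MonoidHom.range_eq_top.2 h.2
    rw [Monoid.Coprod.range_lift] at this
    simpa using this
  · intro X _ φ ψ
    let e := MulEquiv.ofBijective _ h
    refine ⟨(Monoid.Coprod.lift φ ψ).comp e.symm.toMonoidHom, fun f => ?_, fun f => ?_⟩
    · have : e.symm (f : G) = Monoid.Coprod.inl f := by
        rw [MulEquiv.symm_apply_eq]; simp [e]
      simp [this]
    · have : e.symm (f : G) = Monoid.Coprod.inr f := by
        rw [MulEquiv.symm_apply_eq]; simp [e]
      simp [this]

theorem bij_of_ffp {G : Type u} [Group G] (F B : Subgroup G) (h : FFP F B) :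
    Function.Bijective (Monoid.Coprod.lift F.subtype B.subtype) := by
  constructor
  · obtain ⟨θ, h1, h2⟩ := h.2 (Monoid.Coprod F B) Monoid.Coprod.inl Monoid.Coprod.inr
    have : θ.comp (Monoid.Coprod.lift F.subtype B.subtype) = MonoidHom.id _ := by
      apply Monoid.Coprod.hom_ext
      · ext x; simp [h1]
      · ext x; simp [h2]
    intro x y hxy
    have hx := DFunLike.congr_fun this x
    have hy := DFunLike.congr_fun this y
    simp only [MonoidHom.comp_apply, MonoidHom.id_apply] at hx hy
    rw [← hx, ← hy, hxy]
  · rw [← MonoidHom.range_eq_top, Monoid.Coprod.range_lift]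
    simpa using h.1

theorem ffp_map {G : Type u} [Group G] (F B : Subgroup G) (h : FFP F B) (e : G ≃* G) :
    FFP (F.map e.toMonoidHom) (B.map e.toMonoidHom) := by
  constructor
  · rw [← Subgroup.map_sup, h.1]
    exact Subgroup.map_top_of_surjective _ e.surjective
  · intro X _ φ ψ
    obtain ⟨θ, h1, h2⟩ := h.2 X (φ.comp (e.toMonoidHom.subgroupMap F))
      (ψ.comp (e.toMonoidHom.subgroupMap B))
    refine ⟨θ.comp e.symm.toMonoidHom, ?_, ?_⟩
    · rintro ⟨_, f, hf, rfl⟩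
      simpa using! h1 ⟨f, hf⟩
    · rintro ⟨_, f, hf, rfl⟩
      simpa using! h2 ⟨f, hf⟩

theorem gen_induction {G : Type u} [Group G] {F B : Subgroup G} (h : F ⊔ B = ⊤)
    {p : G → Prop} (h1 : p 1) (hF : ∀ f ∈ F, ∀ g, p g → p (f * g))
    (hB : ∀ f ∈ B, ∀ g, p g → p (f * g)) (g : G) : p g := by
  have hg : g ∈ Subgroup.closure ((F : Set G) ∪ B) := by
    rw [← Subgroup.sup_eq_closure, h]; trivial
  induction hg using Subgroup.closure_induction_left with
  | one => exact h1
  | mul_left x hx y hy ih =>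
    rcases hx with hx | hx
    · exact hF x hx _ ih
    · exact hB x hx _ ih
  | inv_mul_cancel x hx y hy ih =>
    rcases hx with hx | hx
    · exact hF _ (F.inv_mem hx) _ ih
    · exact hB _ (B.inv_mem hx) _ ih

section
variable {G : Type u} [Group G] {A : Type u} [MulAction G A] (F B : Subgroup G) (o : A)

inductive P : A → G → Prop
  | one (a) : P a 1
  | stepF (a g f) : P a g → f ∈ F → g • a ≠ o → P a (f * g)
  | stepB (a g b) : P a g → b ∈ B → P a (b * g)

variable {F B o}

theorem P.mul {a : A} {g h : G} (hg : P F B o a g) {c : A} (hh : P F B o c h) (hc : c = g • a) :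
    P F B o a (h * g) := by
  induction hh with
  | one => simpa
  | stepF k f hk hf hne ih =>
    rw [mul_assoc]
    exact P.stepF _ _ _ ih hf (by rwa [mul_smul, ← hc])
  | stepB k f hk hf ih =>
    rw [mul_assoc]
    exact P.stepB _ _ _ ih hf

theorem P.ofB (a : A) {b : G} (hb : b ∈ B) : P F B o a b := by
  simpa using P.stepB (F := F) (o := o) a 1 b (P.one a) hb

theorem P.ofF {a : A} {b : G} (hb : b ∈ F) (ha : a ≠ o) : P F B o a b := by
  simpa using P.stepF (B := B) (o := o) a 1 b (P.one a) hb (by simpa)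

theorem P.inv (hfix : ∀ f ∈ F, f • o = o) {a : A} {g : G} (hg : P F B o a g) :
    P F B o (g • a) g⁻¹ := by
  induction hg with
  | one => simpa using P.one _
  | stepF k f hk hf hne ih =>
    rw [mul_inv_rev]
    refine P.mul (P.ofF (F.inv_mem hf) ?_) ih ?_
    · intro h
      apply hne
      rw [mul_smul, smul_eq_iff_eq_inv_smul, hfix _ (F.inv_mem hf)] at h
      exact h
    · simp [mul_smul]
  | stepB k f hk hf ih =>
    rw [mul_inv_rev]
    refine P.mul (P.ofB _ (B.inv_mem hf)) ih ?_
    simp [mul_smul]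

/-- The complementary factor. -/
def Bc (F B : Subgroup G) (o : A) (hfix : ∀ f ∈ F, f • o = o) : Subgroup G where
  carrier := {g | g • o = o ∧ P F B o o g}
  one_mem' := ⟨one_smul _ _, P.one _⟩
  mul_mem' := by
    rintro a b ⟨ha, ha'⟩ ⟨hb, hb'⟩
    exact ⟨by rw [mul_smul, hb, ha], hb'.mul ha' hb.symm⟩
  inv_mem' := by
    rintro a ⟨ha, ha'⟩
    refine ⟨by rw [inv_smul_eq_iff, ha], ?_⟩
    have := ha'.inv hfix
    rwa [ha] at this

theorem exists_t (h : F ⊔ B = ⊤) (hfix : ∀ f ∈ F, f • o = o) (g : G) :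
    ∃ t : G, t • o = g • o ∧ P F B o o t := by
  refine gen_induction (p := fun g => ∃ t : G, t • o = g • o ∧ P F B o o t) h ?_ ?_ ?_ g
  · exact ⟨1, rfl, P.one _⟩
  · rintro f hf g ⟨t, ht, hp⟩
    by_cases hg : g • o = o
    · exact ⟨1, by rw [mul_smul, hg, hfix f hf, one_smul], P.one _⟩
    · exact ⟨f * t, by rw [mul_smul, mul_smul, ht], P.stepF _ _ _ hp hf (by rwa [ht])⟩
  · rintro f hf g ⟨t, ht, hp⟩
    exact ⟨f * t, by rw [mul_smul, mul_smul, ht], P.stepB _ _ _ hp hf⟩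

theorem exists_transversal (h : F ⊔ B = ⊤) (hfix : ∀ f ∈ F, f • o = o)
    (htr : ∀ a : A, ∃ g : G, g • o = a) :
    ∃ t : A → G, t o = 1 ∧ ∀ a, t a • o = a ∧ P F B o o (t a) := by
  classical
  have : ∀ a : A, ∃ t : G, (t • o = a ∧ P F B o o t) ∧ (a = o → t = 1) := by
    intro a
    by_cases ha : a = o
    · subst ha
      exact ⟨1, ⟨one_smul _ _, P.one _⟩, fun _ => rfl⟩
    · obtain ⟨g, rfl⟩ := htr a
      obtain ⟨t, ht⟩ := exists_t (B := B) h hfix g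
      exact ⟨t, ht, fun h => absurd h ha⟩
  choose t ht ht' using this
  exact ⟨t, ht' o rfl, ht⟩

theorem conj_mem (hfix : ∀ f ∈ F, f • o = o) {t : A → G}
    (ht : ∀ a, t a • o = a ∧ P F B o o (t a)) {a b : A} {g : G} (hg : P F B o a g)
    (hb : g • a = b) : (t b)⁻¹ * g * t a ∈ Bc F B o hfix := by
  refine ⟨?_, ?_⟩
  · rw [mul_smul, mul_smul, (ht a).1, hb, inv_smul_eq_iff, (ht b).1]
  · have h1 := (ht b).2.inv hfix
    rw [(ht b).1] at h1
    rw [mul_assoc]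
    refine P.mul (P.mul (ht a).2 hg (ht a).1.symm) h1 ?_
    rw [mul_smul, (ht a).1, hb]

theorem mem_sup (h : F ⊔ B = ⊤) (hfix : ∀ f ∈ F, f • o = o) {t : A → G} (h1 : t o = 1)
    (ht : ∀ a, t a • o = a ∧ P F B o o (t a)) (g : G) :
    (t (g • o))⁻¹ * g ∈ F ⊔ Bc F B o hfix := by
  have key : ∀ (f g : G), P F B o (g • o) f → (t (g • o))⁻¹ * g ∈ F ⊔ Bc F B o hfix →
      (t ((f * g) • o))⁻¹ * (f * g) ∈ F ⊔ Bc F B o hfix := by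
    intro f g hf hg
    have := Subgroup.mul_mem _ (Subgroup.mem_sup_right (S := F)
      (conj_mem hfix ht hf (mul_smul f g o).symm)) hg
    convert this using 1
    group
  refine gen_induction (p := fun g => (t (g • o))⁻¹ * g ∈ F ⊔ Bc F B o hfix) h ?_ ?_ ?_ g
  · simp [h1, Subgroup.one_mem]
  · intro f hf g hg
    by_cases ho : g • o = o
    · rw [ho, h1] at hg
      rw [mul_smul, ho, hfix f hf, h1]
      have := Subgroup.mul_mem _ (Subgroup.mem_sup_left (T := Bc F B o hfix) hf) hg
      simpa using this
    · exact key f g (P.ofF hf ho) hg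
  · intro f hf g hg
    exact key f g (P.ofB _ hf) hg

/-- Cocycles give homomorphisms to the semidirect product. -/
def cocHom {X : Type u} [Group X] (K : Subgroup G) (c : K → A → X)
    (hc : ∀ (g g' : K) (b : A), c (g * g') b = c g b * c g' ((g : G)⁻¹ • b)) :
    K →* SemidirectProduct (A → X) G (mulAutArrow (G := G)) :=
  MonoidHom.mk' (fun k => ⟨c k, k⟩) (by
    intro a b
    ext1
    · funext x
      exact hc a b x
    · rfl)

theorem exists_coc (h : FFP F B) (X : Type u) [Group X] (cF : F → A → X)
    (hF : ∀ (g g' : F) (b : A), cF (g * g') b = cF g b * cF g' ((g : G)⁻¹ • b)) (cB : B → A → X)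
    (hB : ∀ (g g' : B) (b : A), cB (g * g') b = cB g b * cB g' ((g : G)⁻¹ • b)) :
    ∃ c : G → A → X, (∀ g g' b, c (g * g') b = c g b * c g' (g⁻¹ • b)) ∧
      (∀ f : F, c f = cF f) ∧ (∀ b : B, c b = cB b) := by
  obtain ⟨θ, h1, h2⟩ := h.2 _ (cocHom F cF hF) (cocHom B cB hB)
  have hr : ∀ g, (θ g).right = g := by
    refine gen_induction (p := fun g => (θ g).right = g) h.1 (by simp) ?_ ?_
    · intro f hf g hg
      rw [map_mul, SemidirectProduct.mul_right, hg, h1 ⟨f, hf⟩]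
      rfl
    · intro f hf g hg
      rw [map_mul, SemidirectProduct.mul_right, hg, h2 ⟨f, hf⟩]
      rfl
  refine ⟨fun g => (θ g).left, ?_, ?_, ?_⟩
  · intro g g' b
    simp only [map_mul, SemidirectProduct.mul_left, hr]
    rfl
  · intro f
    simp only [h1]
    rfl
  · intro f
    simp only [h2]
    rfl

theorem ext_stab (h : FFP F B) (hfix : ∀ f ∈ F, f • o = o) {t : A → G} (h1 : t o = 1)
    (ht : ∀ a, t a • o = a ∧ P F B o o (t a)) (X : Type u) [Group X] (φ : F →* X)
    (ψ : Bc F B o hfix →* X) : ∃ c : G → A → X, (∀ g g' b, c (g * g') b = c g b * c g' (g⁻¹ • b)) ∧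
      (∀ f : F, c f o = φ f) ∧ (∀ b : Bc F B o hfix, c b o = ψ b) := by
  classical
  let ψ' : G → X := fun g => if hg : g ∈ Bc F B o hfix then ψ ⟨g, hg⟩ else 1
  have ψ'_mem : ∀ g (hg : g ∈ Bc F B o hfix), ψ' g = ψ ⟨g, hg⟩ := fun g hg => dif_pos hg
  have ψ'_mul : ∀ g k, g ∈ Bc F B o hfix → k ∈ Bc F B o hfix → ψ' (g * k) = ψ' g * ψ' k := by
    intro g k hg hk
    rw [ψ'_mem g hg, ψ'_mem k hk, ψ'_mem _ (mul_mem hg hk), ← map_mul]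
    rfl
  have key : ∀ (g k : G) (b : A), P F B o (g⁻¹ • b) g → P F B o (k⁻¹ • g⁻¹ • b) k →
      ψ' ((t b)⁻¹ * (g * k) * t ((g * k)⁻¹ • b)) =
        ψ' ((t b)⁻¹ * g * t (g⁻¹ • b)) * ψ' ((t (g⁻¹ • b))⁻¹ * k * t (k⁻¹ • g⁻¹ • b)) := by
    intro g k b hg hk
    rw [← ψ'_mul _ _ (conj_mem hfix ht hg (by simp)) (conj_mem hfix ht hk (by simp)),
      mul_inv_rev, mul_smul]
    congr 1
    group
  have hne : ∀ f ∈ F, ∀ b : A, b ≠ o → f⁻¹ • b ≠ o := by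
    intro f hf b hb h
    apply hb
    rw [inv_smul_eq_iff, hfix f hf] at h
    exact h
  obtain ⟨c, hc, hcF, hcB⟩ := exists_coc h X
    (fun (f : F) (b : A) => if b = o then φ f else ψ' ((t b)⁻¹ * f * t ((f : G)⁻¹ • b)))
    (by
      intro f f' b
      by_cases hb : b = o
      · have : (f : G)⁻¹ • b = o := by rw [hb]; exact hfix _ (F.inv_mem f.2)
        simp [hb, this]
        simp [hfix _ (F.inv_mem f.2)]
      · have h2 := hne f f.2 b hb
        have h3 := hne f' f'.2 _ h2
        simp only [if_neg hb, if_neg h2]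
        exact key f f' b (P.ofF f.2 h2) (P.ofF f'.2 h3))
    (fun (f : B) (b : A) => ψ' ((t b)⁻¹ * f * t ((f : G)⁻¹ • b)))
    (by
      intro f f' b
      exact key f f' b (P.ofB _ f.2) (P.ofB _ f'.2))
  refine ⟨c, hc, fun f => by simp [hcF], ?_⟩
  have c1 : ∀ b, c 1 b = 1 := by
    intro b
    simpa using hc 1 1 b
  have main : ∀ (a : A) (g : G), P F B o a g → c g (g • a) = ψ' ((t (g • a))⁻¹ * g * t a) := by
    intro a g hg
    induction hg with
    | one =>
      rw [c1, ψ'_mem _ (conj_mem hfix ht (P.one a) rfl)]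
      have : (⟨_, conj_mem hfix ht (P.one a) rfl⟩ : Bc F B o hfix) = 1 := by
        ext; simp
      rw [this, map_one]
    | stepF k f hk hf hn ih =>
      have hn' : (f * k) • a ≠ o := by
        have := hne _ (F.inv_mem hf) _ hn
        rwa [inv_inv, ← mul_smul] at this
      have e : f⁻¹ • (f * k) • a = k • a := by simp [mul_smul]
      have e2 : k⁻¹ • k • a = a := by simp
      have e3 : (f * k)⁻¹ • (f * k) • a = a := inv_smul_smul _ _
      have := key f k ((f * k) • a) (by rw [e]; exact P.ofF hf hn) (by rw [e, e2]; exact hk)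
      rw [e, e2, e3] at this
      rw [hc, this, e, ih, hcF ⟨f, hf⟩]
      simp only [if_neg hn', e]
    | stepB k f hk hf ih =>
      have e : f⁻¹ • (f * k) • a = k • a := by simp [mul_smul]
      have e2 : k⁻¹ • k • a = a := by simp
      have e3 : (f * k)⁻¹ • (f * k) • a = a := inv_smul_smul _ _
      have := key f k ((f * k) • a) (by rw [e]; exact P.ofB _ hf) (by rw [e, e2]; exact hk)
      rw [e, e2, e3] at this
      rw [hc, this, e, ih, hcB ⟨f, hf⟩]
      simp only [e]
  rintro ⟨g, hg⟩
  have := main o g hg.2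
  rw [hg.1, h1] at this
  simp only [inv_one, one_mul, mul_one] at this
  rw [this, ψ'_mem]
end

theorem ffp_subgroupOf {G : Type u} [Group G] {F B H : Subgroup G} (h : FFP F B) (hle : F ≤ H) :
    ∃ C : Subgroup H, FFP (F.subgroupOf H) C := by
  let o : G ⧸ H := ((1 : G) : G ⧸ H)
  have stab : ∀ g : G, g • o = o ↔ g ∈ H := by
    intro g
    change ((g * 1 : G) : G ⧸ H) = ((1 : G) : G ⧸ H) ↔ _
    rw [mul_one, eq_comm, QuotientGroup.eq]
    simp
  have hfix : ∀ f ∈ F, f • o = o := fun f hf => (stab f).2 (hle hf)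
  have htr : ∀ a : G ⧸ H, ∃ g : G, g • o = a := by
    intro a
    induction a using QuotientGroup.induction_on with
    | H g => exact ⟨g, by change ((g * 1 : G) : G ⧸ H) = _; rw [mul_one]⟩
  obtain ⟨t, h1, ht⟩ := exists_transversal (B := B) h.1 hfix htr
  have hBc : Bc F B o hfix ≤ H := fun g hg => (stab g).1 hg.1
  refine ⟨(Bc F B o hfix).subgroupOf H, ?_, ?_⟩
  · rw [← Subgroup.subgroupOf_sup hle hBc, Subgroup.subgroupOf_eq_top]
    intro g hg
    have := mem_sup h.1 hfix h1 ht g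
    rw [(stab g).2 hg, h1] at this
    simpa using this
  · intro X _ φ ψ
    obtain ⟨c, hc, hF, hB⟩ := ext_stab h hfix h1 ht X
      (φ.comp (Subgroup.subgroupOfEquivOfLe hle).symm.toMonoidHom)
      (ψ.comp (Subgroup.subgroupOfEquivOfLe hBc).symm.toMonoidHom)
    refine ⟨MonoidHom.mk' (fun k : H => c k o) ?_, ?_, ?_⟩
    · intro a b
      change c ((a : G) * b) o = _
      rw [hc, (stab _).2 (H.inv_mem a.2)]
    · rintro ⟨⟨f, hf⟩, hf'⟩
      exact hF ⟨f, hf'⟩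
    · rintro ⟨⟨f, hf⟩, hf'⟩
      exact hB ⟨f, hf'⟩

end KuroshFF

/-- A subgroup `F` of a group `G` is a *free factor* if there is a subgroup `B`
such that `G` is the internal free product `F * B`, i.e. the canonical map
`F ∗ B → G` is bijective. -/
def IsFreeFactor {G : Type*} [Group G] (F : Subgroup G) : Prop :=
  ∃ B : Subgroup G, Function.Bijective (Monoid.Coprod.lift F.subtype B.subtype)

/-- If `H` is a subgroup of a free group `F_n` and `F` is a free factor of `F_n`,
then any conjugate of `F` that is contained in `H` is a free factor of `H`. -/
theorem conj_freeFactor_of_le (n : ℕ) (H F : Subgroup (FreeGroup (Fin n)))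
    (hF : IsFreeFactor F) (c : FreeGroup (Fin n))
    (hc : F.map (MulAut.conj c).toMonoidHom ≤ H) :
    IsFreeFactor ((F.map (MulAut.conj c).toMonoidHom).subgroupOf H) := by
  obtain ⟨B, hB⟩ := hF
  obtain ⟨C, hC⟩ := KuroshFF.ffp_subgroupOf
    (KuroshFF.ffp_map F B (KuroshFF.ffp_of_bij F B hB) (MulAut.conj c)) hc
  exact ⟨C, KuroshFF.bij_of_ffp _ _ hC⟩
end

section
/- If an outer automorphism φ ∈ Out(F_n) fixes the unoriented conjugacy class [x]_u of every basis element x of F_n (n ≥ 3), then φ is the identity. -/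
/-- An element of `F_n` is a *basis element* if it belongs to some free basis,
equivalently it is the image of a generator under some automorphism. -/
def IsBasisElement {n : ℕ} (x : FreeGroup (Fin n)) : Prop :=
  ∃ (e : MulAut (FreeGroup (Fin n))) (i : Fin n), e (FreeGroup.of i) = x

open FreeGroup in
theorem aux_len {α : Type*} [DecidableEq α] {L : List (α × Bool)} (hL : IsCyclicallyReduced L)
    {u : FreeGroup α} (h : IsConj (FreeGroup.mk L) u) : L.length ≤ norm u := by
  obtain ⟨c, hc⟩ := isConj_iff.1 h
  have key : ∀ m : ℕ, m * L.length ≤ 2 * norm c + m * norm u := by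
    intro m
    have h1 : (FreeGroup.mk L) ^ m = c⁻¹ * u ^ m * c := by
      rw [← hc, conj_pow]; group
    have h2 : norm ((FreeGroup.mk L) ^ m) = m * L.length := by
      rw [FreeGroup.norm, toWord_pow, toWord_mk, hL.isReduced.reduce_eq,
        (hL.flatten_replicate m).isReduced.reduce_eq]
      simp
    have h3 : norm (u ^ m) ≤ m * norm u := by
      clear h1 h2
      induction m with
      | zero => simp
      | succ m ih =>
        rw [pow_succ, Nat.succ_mul]
        exact (FreeGroup.norm_mul_le _ _).trans (by omega)
    have h4 := norm_mul_le (c⁻¹ * u ^ m) c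
    have h5 := norm_mul_le (c⁻¹) (u ^ m)
    rw [norm_inv_eq] at h5
    rw [← h2, h1]
    omega
  by_contra hlt
  push Not at hlt
  have h1 := key (2 * norm c + 1)
  have h2 : (2 * norm c + 1) * (norm u + 1) ≤ (2 * norm c + 1) * L.length :=
    Nat.mul_le_mul_left _ hlt
  rw [Nat.mul_add] at h2
  omega

open FreeGroup in
theorem aux_letter {α : Type*} (i : α) (b : Bool) :
    ∃ a : ℤ, FreeGroup.mk [(i, b)] = FreeGroup.of i ^ a := by
  cases b
  · exact ⟨-1, by rw [zpow_neg_one]; rfl⟩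
  · exact ⟨1, by rw [zpow_one]; rfl⟩

open FreeGroup in
theorem aux_key {α : Type*} [DecidableEq α] {i j : α} (hij : i ≠ j) :
    ∀ (m : ℕ) (g : FreeGroup α), norm g ≤ m →
      IsConj (FreeGroup.of i * (g * FreeGroup.of j * g⁻¹)) (FreeGroup.of i * FreeGroup.of j) →
      ∃ a b : ℤ, g = FreeGroup.of i ^ a * FreeGroup.of j ^ b := by
  intro m
  induction m with
  | zero =>
    intro g hg _
    refine ⟨0, 0, ?_⟩
    have : norm g = 0 := by omega
    simpa using norm_eq_zero.1 this
  | succ m ih =>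
    intro g hg hc
    by_cases hh : ∃ a ∈ g.toWord.head?, a.1 = i
    · obtain ⟨⟨i', s⟩, ha, rfl⟩ := hh
      obtain ⟨M, hM⟩ : ∃ M, g.toWord = (i', s) :: M := by
        cases hw : g.toWord with
        | nil => simp [hw] at ha
        | cons x M => simp [hw] at ha; exact ⟨M, by rw [ha]⟩
      obtain ⟨a, hae⟩ := aux_letter i' s
      have hg' : g = FreeGroup.of i' ^ a * FreeGroup.mk M := by
        rw [← hae, mul_mk, ← mk_toWord (x := g), hM]; rfl
      have hn : norm (FreeGroup.mk M) ≤ m := by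
        have h1 : norm (FreeGroup.mk M) ≤ M.length := norm_mk_le
        have h2 : norm g = M.length + 1 := by rw [FreeGroup.norm, hM]; simp
        omega
      obtain ⟨a', b', h'⟩ := ih (FreeGroup.mk M) hn (by
        refine IsConj.trans ?_ hc
        refine isConj_iff.2 ⟨FreeGroup.of i' ^ a, ?_⟩
        rw [hg']
        simp only at *
        group)
      exact ⟨a + a', b', by rw [hg', h', zpow_add, mul_assoc]⟩
    by_cases ht : ∃ a ∈ g.toWord.getLast?, a.1 = j
    · obtain ⟨⟨j', s⟩, ha, rfl⟩ := ht
      obtain ⟨M, hM⟩ : ∃ M, g.toWord = M ++ [(j', s)] := by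
        rw [Option.mem_def, List.getLast?_eq_some_iff] at ha
        exact ha
      obtain ⟨b, hbe⟩ := aux_letter j' s
      have hg' : g = FreeGroup.mk M * FreeGroup.of j' ^ b := by
        rw [← hbe, mul_mk, ← mk_toWord (x := g), hM]
      have hn : norm (FreeGroup.mk M) ≤ m := by
        have h1 : norm (FreeGroup.mk M) ≤ M.length := norm_mk_le
        have h2 : norm g = M.length + 1 := by rw [FreeGroup.norm, hM]; simp
        omega
      obtain ⟨a', b', h'⟩ := ih (FreeGroup.mk M) hn (by
        have : FreeGroup.mk M * FreeGroup.of j' * (FreeGroup.mk M)⁻¹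
            = g * FreeGroup.of j' * g⁻¹ := by
          rw [hg']; group
        simp only at *
        rw [this]; exact hc)
      exact ⟨a', b' + b, by rw [hg', h', zpow_add, mul_assoc]⟩
    push Not at hh ht
    have hcyc : IsCyclicallyReduced ((i, true) :: (g.toWord ++ (j, true) :: invRev g.toWord)) := by
      have hr : IsReduced (invRev g.toWord) := by
        rw [← toWord_inv]; exact isReduced_toWord
      have hr' : IsReduced g.toWord := isReduced_toWord
      generalize g.toWord = L at *
      refine ⟨?_, ?_⟩
      · unfold FreeGroup.IsReduced at *
        rw [List.isChain_cons, List.isChain_append, List.isChain_cons]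
        refine ⟨?_, hr', ⟨?_, hr⟩, ?_⟩
        · intro y hy
          cases L with
          | nil => simp at hy; subst hy; intro h; exact absurd h hij
          | cons x M =>
            simp at hy; subst hy; intro h; exact absurd h.symm (hh x (by simp))
        · intro y hy h
          simp [invRev] at hy
          obtain ⟨p, ⟨h1, h2⟩ | ⟨h1, h2⟩⟩ := hy
          · subst h2; exact absurd h.symm (ht (p, false) h1)
          · subst h2; exact absurd h.symm (ht (p, true) h1)
        · intro x hx y hy h
          simp at hy; subst hy
          exact absurd h (ht x hx)
      · intro a ha b hb h
        simp at hb; subst hb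
        rw [Option.mem_def, List.getLast?_eq_some_iff] at ha
        cases L with
        | nil =>
          simp [invRev] at ha
          grind
        | cons x M =>
          have hx := hh x (by simp)
          have hz : (i, true) :: (x :: M ++ (j, true) :: invRev (x :: M)) =
              ((i, true) :: (x :: M ++ (j, true) :: invRev M)) ++ [(x.1, !x.2)] := by
            simp [invRev]
          obtain ⟨ys, hy⟩ := ha
          rw [hz] at hy
          have h5 := congrArg List.getLast? hy
          rw [List.getLast?_concat, List.getLast?_concat] at h5
          have h6 := Option.some.inj h5
          subst h6
          exact absurd h hx
    have hl := aux_len hcyc (u := FreeGroup.of i * FreeGroup.of j) (by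
      convert hc using 1
      rw [← mk_toWord (x := g)]
      simp [FreeGroup.of, inv_mk, mul_mk])
    have h2 := norm_mul_le (FreeGroup.of i) (FreeGroup.of j)
    simp at hl h2
    have : norm g = 0 := by unfold FreeGroup.norm; omega
    exact ⟨0, 0, by simpa using norm_eq_zero.1 this⟩

theorem aux_core {n : ℕ} (hn : 3 ≤ n) (ψ : FreeGroup (Fin n) →* FreeGroup (Fin n))
    (h1 : ∀ i, IsConj (FreeGroup.of i) (ψ (FreeGroup.of i)))
    (h2 : ∀ i j, i ≠ j → IsConj (FreeGroup.of i * FreeGroup.of j)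
      (ψ (FreeGroup.of i * FreeGroup.of j))) :
    ∃ c : FreeGroup (Fin n), ∀ g, ψ g = c * g * c⁻¹ := by
  choose g hg using fun i => isConj_iff.1 (h1 i)
  have key : ∀ i j, i ≠ j → ∃ a b : ℤ, g j = g i * FreeGroup.of i ^ a * FreeGroup.of j ^ b := by
    intro i j hij
    obtain ⟨a, b, h⟩ := aux_key hij _ ((g i)⁻¹ * g j) le_rfl (by
      refine IsConj.trans ?_ (h2 i j hij).symm
      refine isConj_iff.2 ⟨g i, ?_⟩
      rw [map_mul, ← hg i, ← hg j]
      group)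
    exact ⟨a, b, by rw [mul_assoc, ← h]; group⟩
  let i0 : Fin n := ⟨0, by omega⟩
  let i1 : Fin n := ⟨1, by omega⟩
  have h01 : i0 ≠ i1 := by simp [i0, i1]
  obtain ⟨a, b, hab⟩ := key i0 i1 h01
  have hc0 : ∃ c, c = g i0 * FreeGroup.of i0 ^ a := ⟨_, rfl⟩
  obtain ⟨c, hc⟩ := hc0
  refine ⟨c, ?_⟩
  have hgen : ∀ k, ψ (FreeGroup.of k) = c * FreeGroup.of k * c⁻¹ := by
    intro k
    rw [← hg k]
    by_cases hk0 : k = i0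
    · subst hk0; rw [hc]; group
    by_cases hk1 : k = i1
    · subst hk1; rw [hab, ← hc]; group
    obtain ⟨p, q, hpq⟩ := key i0 k (Ne.symm hk0)
    obtain ⟨r, s, hrs⟩ := key i1 k (Ne.symm hk1)
    have e : p = a := by
      have hh := hpq.symm.trans hrs
      rw [hab] at hh
      have := congrArg (FreeGroup.lift (fun t : Fin n =>
        if t = i0 then Multiplicative.ofAdd (1 : ℤ) else 1)) hh
      simp [hk0, Ne.symm h01] at this
      have := congrArg Multiplicative.toAdd this
      simpa using this
    rw [hpq, e, ← hc]; group
  intro x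
  have : ψ = (MulAut.conj c).toMonoidHom := by
    ext k
    simp [hgen k]
  rw [this]; simp

/-- transvection -/
noncomputable def auxT {n : ℕ} (i j : Fin n) (hij : i ≠ j) : MulAut (FreeGroup (Fin n)) :=
  MonoidHom.toMulEquiv
    (FreeGroup.lift (Function.update FreeGroup.of i (FreeGroup.of i * FreeGroup.of j)))
    (FreeGroup.lift (Function.update FreeGroup.of i (FreeGroup.of i * (FreeGroup.of j)⁻¹)))
    (by
      ext k
      by_cases hk : k = i
      · subst hk; simp [Function.update_of_ne hij.symm]
      · simp [Function.update_of_ne hk])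
    (by
      ext k
      by_cases hk : k = i
      · subst hk; simp [Function.update_of_ne hij.symm]
      · simp [Function.update_of_ne hk])

theorem auxT_self {n : ℕ} (i j : Fin n) (hij : i ≠ j) :
    auxT i j hij (FreeGroup.of i) = FreeGroup.of i * FreeGroup.of j := by
  simp [auxT]

theorem auxT_ne {n : ℕ} (i j k : Fin n) (hij : i ≠ j) (hk : k ≠ i) :
    auxT i j hij (FreeGroup.of k) = FreeGroup.of k := by
  simp [auxT, Function.update_of_ne hk]

theorem aux_conj_map {G A : Type*} [Group G] [CommGroup A] (f : G →* A) {x y : G}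
    (h : IsConj x y) : f x = f y := by
  obtain ⟨c, rfl⟩ := isConj_iff.1 h
  simp

/-- If an (outer) automorphism of `F_n`, `n ≥ 3`, fixes the unoriented conjugacy
class of every basis element, then it is the identity in `Out(F_n)`, i.e. any
representing automorphism is inner. -/
theorem recognize_identity (n : ℕ) (hn : 3 ≤ n) (φ : MulAut (FreeGroup (Fin n)))
    (h : ∀ x : FreeGroup (Fin n), IsBasisElement x →
      (IsConj x (φ x) ∨ IsConj x⁻¹ (φ x))) :
    ∃ c : FreeGroup (Fin n), ∀ g : FreeGroup (Fin n), φ g = c * g * c⁻¹ := by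
  have b1 : ∀ i, IsConj (FreeGroup.of i) (φ (FreeGroup.of i)) ∨
      IsConj (FreeGroup.of i)⁻¹ (φ (FreeGroup.of i)) := fun i => h _ ⟨1, i, rfl⟩
  have b2 : ∀ i j, i ≠ j → IsConj (FreeGroup.of i * FreeGroup.of j)
      (φ (FreeGroup.of i * FreeGroup.of j)) ∨ IsConj (FreeGroup.of i * FreeGroup.of j)⁻¹
      (φ (FreeGroup.of i * FreeGroup.of j)) :=
    fun i j hij => h _ ⟨auxT i j hij, i, auxT_self i j hij⟩
  let f : Fin n → (FreeGroup (Fin n) →* Multiplicative ℤ) := fun j => FreeGroup.lift (fun t =>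
        if t = j then Multiplicative.ofAdd (2 : ℤ) else Multiplicative.ofAdd (1 : ℤ))
  have f1 : ∀ j, (f j (FreeGroup.of j)).toAdd = 2 := by intro j; simp [f]
  have f2 : ∀ i j, i ≠ j → (f j (FreeGroup.of i)).toAdd = 1 := by
    intro i j hij; simp [f, hij]
  -- sign analysis
  have sgn : ∀ i j, i ≠ j →
      (IsConj (FreeGroup.of i) (φ (FreeGroup.of i)) ∧ IsConj (FreeGroup.of j) (φ (FreeGroup.of j))
        ∧ IsConj (FreeGroup.of i * FreeGroup.of j) (φ (FreeGroup.of i * FreeGroup.of j))) ∨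
      (IsConj (FreeGroup.of i)⁻¹ (φ (FreeGroup.of i)) ∧
        IsConj (FreeGroup.of j)⁻¹ (φ (FreeGroup.of j))
        ∧ IsConj (FreeGroup.of i * FreeGroup.of j)⁻¹ (φ (FreeGroup.of i * FreeGroup.of j))) := by
    intro i j hij
    have e1 := f1 j
    have e2 := f2 i j hij
    rcases b1 i with hi | hi <;> rcases b1 j with hj | hj <;> rcases b2 i j hij with hk | hk
    all_goals
      first
      | exact Or.inl ⟨hi, hj, hk⟩
      | exact Or.inr ⟨hi, hj, hk⟩
      | exfalso
        have p1 := congrArg Multiplicative.toAdd (aux_conj_map (f j) hi)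
        have p2 := congrArg Multiplicative.toAdd (aux_conj_map (f j) hj)
        have p3 := congrArg Multiplicative.toAdd (aux_conj_map (f j) hk)
        simp only [map_mul, map_inv, toAdd_mul, toAdd_inv, e1, e2] at p1 p2 p3
        omega
  have sgn0 : ∀ i, ¬ (IsConj (FreeGroup.of i) (φ (FreeGroup.of i)) ∧
      IsConj (FreeGroup.of i)⁻¹ (φ (FreeGroup.of i))) := by
    rintro i ⟨hi, hj⟩
    have e1 := f1 i
    have p1 := congrArg Multiplicative.toAdd (aux_conj_map (f i) hi)
    have p2 := congrArg Multiplicative.toAdd (aux_conj_map (f i) hj)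
    simp only [map_inv, toAdd_inv, e1] at p1 p2
    omega
  let i0 : Fin n := ⟨0, by omega⟩
  let i1 : Fin n := ⟨1, by omega⟩
  let i2 : Fin n := ⟨2, by omega⟩
  have h01 : i0 ≠ i1 := by simp [i0, i1]
  have h02 : i0 ≠ i2 := by simp [i0, i2]
  have h12 : i1 ≠ i2 := by simp [i1, i2]
  rcases b1 i0 with hp | hm
  · have all : ∀ i, IsConj (FreeGroup.of i) (φ (FreeGroup.of i)) := by
      intro i
      by_cases hi : i = i0
      · subst hi; exact hp
      rcases sgn i i0 hi with hh | hh
      · exact hh.1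
      · exact absurd ⟨hp, hh.2.1⟩ (sgn0 _)
    refine aux_core hn φ.toMonoidHom all ?_
    intro i j hij
    rcases sgn i j hij with hh | hh
    · exact hh.2.2
    · exact absurd ⟨all i, hh.1⟩ (sgn0 _)
  · exfalso
    have all : ∀ i, IsConj (FreeGroup.of i)⁻¹ (φ (FreeGroup.of i)) := by
      intro i
      by_cases hi : i = i0
      · subst hi; exact hm
      rcases sgn i i0 hi with hh | hh
      · exact absurd ⟨hh.2.1, hm⟩ (sgn0 _)
      · exact hh.1
    have inv_conj : ∀ x y : FreeGroup (Fin n), IsConj x⁻¹ y → IsConj x y⁻¹ := by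
      intro x y hxy
      obtain ⟨c, rfl⟩ := isConj_iff.1 hxy
      exact isConj_iff.2 ⟨c, by group⟩
    obtain ⟨c, hc⟩ := aux_core hn
      (φ.toMonoidHom.comp (FreeGroup.lift (fun i => (FreeGroup.of i)⁻¹)))
      (by
        intro i
        simpa using inv_conj _ _ (all i))
      (by
        intro i j hij
        rcases sgn j i hij.symm with hh | hh
        · exact absurd ⟨hh.1, all j⟩ (sgn0 _)
        · have h3 := inv_conj _ _ hh.2.2
          have h4 : IsConj (FreeGroup.of i * FreeGroup.of j) (FreeGroup.of j * FreeGroup.of i) :=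
            isConj_iff.2 ⟨FreeGroup.of j, by group⟩
          simpa using h4.trans h3)
    have hgen : ∀ i, φ (FreeGroup.of i) = c * (FreeGroup.of i)⁻¹ * c⁻¹ := by
      intro i
      have := congrArg (·⁻¹) (hc (FreeGroup.of i))
      simp at this
      rw [this]; group
    have b3 := h (FreeGroup.of i0 * (FreeGroup.of i1 * FreeGroup.of i2))
      ⟨auxT i1 i2 h12 * auxT i0 i1 h01, i0, by
        rw [MulAut.mul_apply, auxT_self, map_mul, auxT_self, auxT_ne _ _ _ _ h01]⟩
    have e3 : IsConj ((FreeGroup.of i0)⁻¹ * (FreeGroup.of i1)⁻¹ * (FreeGroup.of i2)⁻¹)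
        (φ (FreeGroup.of i0 * (FreeGroup.of i1 * FreeGroup.of i2))) := by
      refine isConj_iff.2 ⟨c, ?_⟩
      rw [map_mul, map_mul, hgen, hgen, hgen]; group
    rcases b3 with hb | hb
    · have p := congrArg Multiplicative.toAdd (aux_conj_map (f i0) (hb.trans e3.symm))
      simp only [map_mul, map_inv, toAdd_mul, toAdd_inv, f1, f2 _ _ h01.symm, f2 _ _ h02.symm] at p
      omega
    · have q := hb.trans e3.symm
      let F : FreeGroup (Fin n) →* Equiv.Perm (Fin 3) := FreeGroup.lift (fun t =>
        if t = i0 then Equiv.swap 0 1 else if t = i1 then Equiv.swap 1 2 else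
          Equiv.swap 1 2 * Equiv.swap 0 1)
      have q' := F.map_isConj q
      have F0 : F (FreeGroup.of i0) = Equiv.swap 0 1 := by simp [F]
      have F1 : F (FreeGroup.of i1) = Equiv.swap 1 2 := by simp [F, h01.symm]
      have F2 : F (FreeGroup.of i2) = Equiv.swap 1 2 * Equiv.swap 0 1 := by
        simp [F, h02.symm, h12.symm]
      simp only [map_mul, map_inv, F0, F1, F2] at q'
      rw [isConj_iff] at q'
      revert q'
      decide
end

section
/- Let F_n = F_2 * F_{n−2} where F_2 = ⟨x_1,x_2⟩ and F_{n−2} = ⟨x_3,…,x_n⟩. The subgroup splitOut = {φ ∈ Out(F_n) : both [F_2] and [F_{n−2}] are φ-invariant} is isomorphic to Aut(F_2) × Aut(F_{n−2}) via the map induced by the natural inclusion Aut(F_2) × Aut(F_{n−2}) → Aut(F_n) → Out(F_n). In particular, this induced map is injective and its image is exactly splitOut. -/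
/-- The subgroup of inner automorphisms of a group `G`. -/
def Inn (G : Type*) [Group G] : Subgroup (MulAut G) := (MulAut.conj : G →* MulAut G).range

instance Inn.normal (G : Type*) [Group G] : (Inn G).Normal := by
  constructor
  rintro x ⟨c, rfl⟩ θ
  refine ⟨θ c, ?_⟩
  ext g
  simp [MulAut.conj_apply, mul_assoc, map_mul, map_inv]

/-- The free factor `F_2 = ⟨x_1, x_2⟩` of `F_n`. -/
def F2sub (n : ℕ) : Subgroup (FreeGroup (Fin n)) :=
  Subgroup.closure (FreeGroup.of '' {i : Fin n | (i : ℕ) < 2})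

/-- The free factor `F_{n-2} = ⟨x_3, …, x_n⟩` of `F_n`. -/
def Fm2sub (n : ℕ) : Subgroup (FreeGroup (Fin n)) :=
  Subgroup.closure (FreeGroup.of '' {i : Fin n | 2 ≤ (i : ℕ)})

/-- The conjugacy class of the subgroup `H` is invariant under the automorphism `φ`. -/
def ConjInvariant {G : Type*} [Group G] (φ : MulAut G) (H : Subgroup G) : Prop :=
  ∃ c : G, H.map φ.toMonoidHom = H.map (MulAut.conj c).toMonoidHom

section Core
open Monoid Monoid.CoprodI
open scoped Pointwise

variable {G : Bool → Type} [∀ i, Group (G i)]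

theorem sp_strip_last {i j : Bool} (w : NeWord G i j) :
    ∃ (b : G j) (x : CoprodI G), w.prod = x * of b ∧
      ((x = 1 ∧ i = j) ∨ ∃ w' : NeWord G i (!j), x = w'.prod) := by
  induction w with
  | singleton x hx => exact ⟨x, 1, by simp, Or.inl ⟨rfl, rfl⟩⟩
  | @append i j k l w₁ hne w₂ ih₁ ih₂ =>
    obtain ⟨b, x, hx, h⟩ := ih₂
    refine ⟨b, w₁.prod * x, by simp [hx, mul_assoc], Or.inr ?_⟩
    rcases h with ⟨rfl, rfl⟩ | ⟨w', rfl⟩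
    · obtain rfl : j = !k := by revert hne; cases j <;> cases k <;> simp
      exact ⟨w₁, by simp⟩
    · exact ⟨NeWord.append w₁ hne w', by simp⟩

theorem sp_neword (g : CoprodI G) : g = 1 ∨ ∃ (i j : Bool) (w : NeWord G i j), w.prod = g := by
  classical
  by_cases h : Word.equiv g = Word.empty
  · left
    have := congrArg Word.equiv.symm h
    rw [Equiv.symm_apply_apply] at this
    rw [this]; exact Word.prod_empty
  · right
    obtain ⟨i, j, w, hw⟩ := NeWord.of_word _ h
    refine ⟨i, j, w, ?_⟩
    rw [NeWord.prod, hw]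
    exact Word.equiv.symm_apply_apply g

theorem sp_toList {i j k l : Bool} (w : NeWord G i j) (w' : NeWord G k l)
    (h : w.prod = w'.prod) : w.toList = w'.toList := by
  classical
  have : w.toWord = w'.toWord := Word.equiv.symm.injective h
  exact congrArg Word.toList this

theorem sp_right (i : Bool) (g : CoprodI G) :
    ∃ (b : G i) (x : CoprodI G), g = x * of b ∧ (x = 1 ∨ ∃ k, ∃ w : NeWord G k (!i), x = w.prod) := by
  rcases sp_neword g with rfl | ⟨k, j, w, rfl⟩
  · exact ⟨1, 1, by simp, Or.inl rfl⟩
  · by_cases hj : j = i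
    · subst hj
      obtain ⟨b, x, h1, h2⟩ := sp_strip_last w
      refine ⟨b, x, h1, ?_⟩
      rcases h2 with ⟨h, _⟩ | h
      · exact Or.inl h
      · exact Or.inr ⟨k, h⟩
    · obtain rfl : j = !i := by revert hj; cases j <;> cases i <;> simp
      exact ⟨1, w.prod, by simp, Or.inr ⟨k, w, rfl⟩⟩

theorem sp_double (g : CoprodI G) :
    ∃ (a : G true) (b : G false) (x : CoprodI G), g = of a * x * of b ∧
      (x = 1 ∨ ∃ w : NeWord G false true, x = w.prod) := by
  obtain ⟨a, y, h1, h2⟩ := sp_right true g⁻¹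
  have hg : g = of a⁻¹ * y⁻¹ := by
    rw [← inv_inv g, h1]; simp
  rcases h2 with rfl | ⟨k, w, rfl⟩
  · exact ⟨a⁻¹, 1, 1, by simp [hg], Or.inl rfl⟩
  · rw [← NeWord.inv_prod] at hg
    cases k with
    | true => exact ⟨a⁻¹, 1, _, by simp [hg], Or.inr ⟨w.inv, rfl⟩⟩
    | false =>
      obtain ⟨b, x, h3, h4⟩ := sp_strip_last w.inv
      refine ⟨a⁻¹, b, x, by rw [hg, h3, mul_assoc], ?_⟩
      rcases h4 with ⟨h, _⟩ | h
      · exact Or.inl h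
      · exact Or.inr h

theorem sp_malnormal (i : Bool) [Nontrivial (G i)] (c : CoprodI G)
    (h : ∀ x : G i, ∃ y : G i, c * of x * c⁻¹ = of y) : ∃ b : G i, c = of b := by
  obtain ⟨b, x, rfl, hx⟩ := sp_right i c
  rcases hx with rfl | ⟨k, w, rfl⟩
  · exact ⟨b, by simp⟩
  exfalso
  obtain ⟨a, ha⟩ := exists_ne (1 : G i)
  obtain ⟨y, hy⟩ := h (b⁻¹ * a * b)
  have hi : (!i) ≠ i := by cases i <;> simp
  let W := NeWord.append (NeWord.append w hi (NeWord.singleton a ha)) hi.symm w.inv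
  have hW : W.prod = of y := by
    rw [← hy]; simp [W, mul_assoc]
  have hy1 : y ≠ 1 := by
    rintro rfl
    rw [map_one] at hy
    have : (of a : CoprodI G) = 1 := by
      have h2 := conj_eq_one_iff.mp hy
      rw [map_mul, map_mul, map_inv] at h2
      have h3 : (of b : CoprodI G)⁻¹ * of a * ((of b)⁻¹)⁻¹ = 1 := by rw [inv_inv]; exact h2
      exact conj_eq_one_iff.mp h3
    exact ha (of_injective i (by rw [this, map_one]))
  have := sp_toList W (NeWord.singleton y hy1) (by simp [hW])
  have h1 := List.length_pos_of_ne_nil w.toList_ne_nil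
  have := congrArg List.length this
  simp [W] at this
  omega

theorem sp_image (g : NeWord G false true) (f : CoprodI G →* CoprodI G)
    (h1 : ∀ x : G true, f (of x) = of x)
    (h2 : ∀ x : G false, f (of x) = g.prod * of x * g.prod⁻¹) {i j : Bool} (w : NeWord G i j) :
    ∃ w' : NeWord G i j, f w.prod = w'.prod ∧ (i = false → 1 < w'.toList.length) := by
  induction w with
  | @singleton i x hx =>
    cases i with
    | true => exact ⟨NeWord.singleton x hx, by simp [h1], by simp⟩
    | false =>
      refine ⟨NeWord.append (NeWord.append g (by simp) (NeWord.singleton x hx)) (by simp) g.inv,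
        by simp [h2], fun _ => ?_⟩
      have h1 := List.length_pos_of_ne_nil g.toList_ne_nil
      simp
      omega
  | append w₁ hne w₂ ih₁ ih₂ =>
    obtain ⟨v₁, a1, b1⟩ := ih₁
    obtain ⟨v₂, a2, b2⟩ := ih₂
    refine ⟨NeWord.append v₁ hne v₂, by simp [a1, a2], fun h => ?_⟩
    have := b1 h
    simp
    omega

theorem sp_generate [Nontrivial (G false)] (g : CoprodI G) (f : CoprodI G →* CoprodI G)
    (h1 : ∀ x : G true, f (of x) = of x)
    (h2 : ∀ x : G false, f (of x) = g * of x * g⁻¹) (hf : Function.Surjective f) :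
    ∃ (a : G true) (b : G false), g = of a * of b := by
  obtain ⟨a, b, x, rfl, hx⟩ := sp_double g
  rcases hx with rfl | ⟨w, rfl⟩
  · exact ⟨a, b, by simp⟩
  exfalso
  let f' : CoprodI G →* CoprodI G := CoprodI.lift fun i => match i with
    | true => of
    | false => (MulAut.conj w.prod).toMonoidHom.comp of
  have k1 : ∀ x : G true, f' (of x) = of x := fun x => by simp [f', lift_of]
  have k2 : ∀ x : G false, f' (of x) = w.prod * of x * w.prod⁻¹ := fun x => by
    simp [f', lift_of]
  have hle : ∀ z, (of a)⁻¹ * f z * of a ∈ f'.range := by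
    intro z
    induction z using CoprodI.induction_on with
    | one => simp
    | of i x =>
      cases i with
      | true => exact ⟨of (a⁻¹ * x * a), by rw [k1, h1]; simp⟩
      | false => exact ⟨of (b * x * b⁻¹), by rw [k2, h2]; simp [mul_assoc]⟩
    | mul x y hx hy =>
      have := f'.range.mul_mem hx hy
      simpa [mul_assoc] using this
  obtain ⟨b0, hb0⟩ := exists_ne (1 : G false)
  obtain ⟨z, hz⟩ := hf (of a * of b0 * (of a)⁻¹)
  obtain ⟨u, hu⟩ := hle z
  have hu : f' u = of b0 := by rw [hu, hz]; group
  rcases sp_neword u with rfl | ⟨i, j, v, rfl⟩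
  · rw [map_one] at hu
    exact hb0 (of_injective false (by rw [← hu, map_one]))
  · obtain ⟨v', e1, e2⟩ := sp_image w f' k1 k2 v
    have := sp_toList v' (NeWord.singleton b0 hb0) (by rw [← e1, hu]; simp)
    have hh := v'.toList_head?
    rw [this] at hh
    simp at hh
    have := congrArg List.length this
    simp at this
    have := e2 hh.1
    omega

theorem sp_P_malnormal {P : Type} [Group P] (j : ∀ i, G i →* P)
    (hj : Function.Bijective (CoprodI.lift j)) (i : Bool) [Nontrivial (G i)] (c : P)
    (h : MulAut.conj c • (j i).range ≤ (j i).range) : c ∈ (j i).range := by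
  obtain ⟨c, rfl⟩ := hj.2 c
  obtain ⟨b, rfl⟩ := sp_malnormal i c (fun x => by
    obtain ⟨y, hy⟩ := h (Subgroup.smul_mem_pointwise_smul _ (MulAut.conj (CoprodI.lift j c)) _ ⟨x, rfl⟩)
    refine ⟨y, hj.1 ?_⟩
    simp [lift_of, hy])
  exact ⟨b, by simp [lift_of]⟩

theorem sp_P_generate {P : Type} [Group P] (j : ∀ i, G i →* P)
    (hj : Function.Bijective (CoprodI.lift j)) [Nontrivial (G false)] (g : P)
    (h : (j true).range ⊔ MulAut.conj g • (j false).range = ⊤) :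
    ∃ (a : G true) (b : G false), g = j true a * j false b := by
  obtain ⟨g, rfl⟩ := hj.2 g
  let f : CoprodI G →* CoprodI G := CoprodI.lift fun i => match i with
    | true => of
    | false => (MulAut.conj g).toMonoidHom.comp of
  have k1 : ∀ x : G true, f (of x) = of x := fun x => by simp [f, lift_of]
  have k2 : ∀ x : G false, f (of x) = g * of x * g⁻¹ := fun x => by
    simp [f, lift_of]
  have hs : ((CoprodI.lift j).comp f).range = ⊤ := by
    rw [eq_top_iff, ← h, sup_le_iff]
    constructor
    · rintro _ ⟨x, rfl⟩
      exact ⟨of x, by simp [k1, lift_of]⟩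
    · intro y hy
      obtain ⟨_, ⟨x, rfl⟩, rfl⟩ := hy
      exact ⟨of x, by simp [k2, lift_of]⟩
  obtain ⟨a, b, rfl⟩ := sp_generate g f k1 k2 (fun y => by
    obtain ⟨x, hx⟩ := MonoidHom.range_eq_top.mp hs (CoprodI.lift j y)
    exact ⟨x, hj.1 hx⟩)
  exact ⟨a, b, by simp [lift_of]⟩

theorem sp_P_inter {P : Type} [Group P] (j : ∀ i, G i →* P)
    (hj : Function.Bijective (CoprodI.lift j)) (c : P)
    (h1 : c ∈ (j true).range) (h2 : c ∈ (j false).range) : c = 1 := by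
  obtain ⟨a, rfl⟩ := h1
  obtain ⟨b, hb⟩ := h2
  have : (of a : CoprodI G) = of b := hj.1 (by simp [lift_of, hb])
  let f : CoprodI G →* G true := CoprodI.lift fun i => match i with
    | true => MonoidHom.id _
    | false => 1
  have := congrArg f this
  simp [f, lift_of] at this
  simp [this]

theorem sp_restrict {K P : Type} [Group K] [Group P] (k : K →* P) (hk : Function.Injective k)
    (φ : MulAut P) (h : φ • k.range = k.range) : ∃ α : MulAut K, ∀ x, k (α x) = φ (k x) := by
  have h' : k.range.map φ.toMonoidHom = k.range := h
  let e := MonoidHom.ofInjective hk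
  let α : K ≃* K := ((e.trans (φ.subgroupMap k.range)).trans (MulEquiv.subgroupCongr h')).trans e.symm
  refine ⟨α, fun x => ?_⟩
  have : e (α x) = MulEquiv.subgroupCongr h' (φ.subgroupMap k.range (e x)) := by
    simp only [α, MulEquiv.trans_apply]
    exact e.apply_symm_apply _
  exact congrArg Subtype.val this

theorem sp_fix {P : Type} [Group P] (j : ∀ i, G i →* P)
    (hj : Function.Bijective (CoprodI.lift j)) [Nontrivial (G false)] (φ : MulAut P)
    (h1 : ∃ c : P, φ • (j true).range = MulAut.conj c • (j true).range)
    (h2 : ∃ c : P, φ • (j false).range = MulAut.conj c • (j false).range) :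
    ∃ c : P, ∀ i, (MulAut.conj c * φ) • (j i).range = (j i).range := by
  obtain ⟨a, ha⟩ := h1
  obtain ⟨b, hb⟩ := h2
  have htop : (j true).range ⊔ (j false).range = ⊤ := by
    rw [eq_top_iff]
    intro y _
    obtain ⟨x, rfl⟩ := hj.2 y
    induction x using CoprodI.induction_on with
    | one => simp
    | of i x =>
      rw [lift_of]
      cases i with
      | true => exact Subgroup.mem_sup_left ⟨x, rfl⟩
      | false => exact Subgroup.mem_sup_right ⟨x, rfl⟩
    | mul x y hx hy =>
      rw [map_mul]
      exact mul_mem (hx trivial) (hy trivial)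
  have ht : (MulAut.conj a⁻¹ * φ) • (⊤ : Subgroup P) = ⊤ := by
    rw [eq_top_iff]
    intro y _
    exact ⟨(MulAut.conj a⁻¹ * φ)⁻¹ y, trivial, MulAut.apply_inv_self P (MulAut.conj a⁻¹ * φ) y⟩
  obtain ⟨u, v, huv⟩ := sp_P_generate j hj (a⁻¹ * b) (by
    rw [← htop, Subgroup.smul_sup, mul_smul, mul_smul, ha, hb, smul_smul, smul_smul, ← map_mul,
      ← map_mul, htop] at ht
    simpa using ht)
  refine ⟨(j true u)⁻¹ * a⁻¹, fun i => ?_⟩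
  cases i with
  | true =>
    rw [mul_smul, ha, smul_smul, ← map_mul]
    exact Subgroup.conj_smul_eq_self_of_mem ⟨u⁻¹, by simp⟩
  | false =>
    rw [mul_smul, hb, smul_smul, ← map_mul]
    exact Subgroup.conj_smul_eq_self_of_mem ⟨v, by rw [mul_assoc, huv]; simp⟩
end Core

section Free
open Monoid Monoid.CoprodI
open scoped Pointwise

abbrev spT (n : ℕ) (b : Bool) : Type := Fin (cond b 2 (n - 2))

def spEmb (n : ℕ) (hn : 4 ≤ n) : ∀ b, spT n b → Fin n
  | true => fun j => ⟨j.1, by have : j.1 < 2 := j.2; omega⟩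
  | false => fun j => ⟨j.1 + 2, by have : j.1 < n - 2 := j.2; omega⟩

def spJ (n : ℕ) (hn : 4 ≤ n) (b : Bool) : FreeGroup (spT n b) →* FreeGroup (Fin n) :=
  FreeGroup.map (spEmb n hn b)

theorem spEmb_inj (n : ℕ) (hn : 4 ≤ n) (b : Bool) : Function.Injective (spEmb n hn b) := by
  cases b <;> intro x y h <;> simpa [spEmb, Fin.ext_iff] using h

theorem spJ_inj (n : ℕ) (hn : 4 ≤ n) (b : Bool) : Function.Injective (spJ n hn b) :=
  FreeGroup.map_injective (spEmb_inj n hn b)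

theorem spEmb_cases (n : ℕ) (hn : 4 ≤ n) (i : Fin n) :
    (∃ x, i = spEmb n hn true x) ∨ ∃ x, i = spEmb n hn false x := by
  by_cases h : i.1 < 2
  · exact Or.inl ⟨⟨i.1, h⟩, rfl⟩
  · refine Or.inr ⟨⟨i.1 - 2, by have := i.2; simp; omega⟩, ?_⟩
    simp only [spEmb, Fin.ext_iff]; omega

theorem spJ_bij (n : ℕ) (hn : 4 ≤ n) : Function.Bijective (CoprodI.lift (spJ n hn)) := by
  let r : FreeGroup (Fin n) →* CoprodI (fun b => FreeGroup (spT n b)) :=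
    FreeGroup.lift fun i => if h : i.1 < 2 then
        of (i := true) (FreeGroup.of (⟨i.1, h⟩ : spT n true))
      else of (i := false) (FreeGroup.of (⟨i.1 - 2, by have := i.2; simp; omega⟩ : spT n false))
  have r1 : ∀ x, r (FreeGroup.of (spEmb n hn true x)) = of (i := true) (FreeGroup.of x) := by
    intro x
    simp only [r, FreeGroup.lift_apply_of]
    rw [dif_pos (show (spEmb n hn true x).1 < 2 from x.2)]
    rfl
  have r2 : ∀ x, r (FreeGroup.of (spEmb n hn false x)) = of (i := false) (FreeGroup.of x) := by
    intro x
    simp only [r, FreeGroup.lift_apply_of]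
    rw [dif_neg (show ¬ (spEmb n hn false x).1 < 2 by simp [spEmb])]
    rfl
  refine Function.bijective_iff_has_inverse.mpr ⟨r, fun x => ?_, fun x => ?_⟩
  · have : r.comp (CoprodI.lift (spJ n hn)) = MonoidHom.id _ := by
      ext b x
      cases b with
      | true => simp [lift_of, spJ, r1]
      | false => simp [lift_of, spJ, r2]
    exact DFunLike.congr_fun this x
  · have : (CoprodI.lift (spJ n hn)).comp r = MonoidHom.id _ := by
      ext i
      rcases spEmb_cases n hn i with ⟨x, rfl⟩ | ⟨x, rfl⟩
      · simp [r1, lift_of, spJ]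
      · simp [r2, lift_of, spJ]
    exact DFunLike.congr_fun this x

theorem spJ_range (n : ℕ) (hn : 4 ≤ n) (b : Bool) :
    (spJ n hn b).range = Subgroup.closure (FreeGroup.of '' Set.range (spEmb n hn b)) := by
  rw [MonoidHom.range_eq_map, ← FreeGroup.closure_range_of, MonoidHom.map_closure,
    ← Set.range_comp, ← Set.range_comp]
  congr 2

theorem F2sub_eq (n : ℕ) (hn : 4 ≤ n) : F2sub n = (spJ n hn true).range := by
  rw [spJ_range, F2sub]
  congr 2
  ext i
  constructor
  · intro h
    exact ⟨⟨i.1, h⟩, rfl⟩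
  · rintro ⟨x, rfl⟩
    exact x.2

theorem Fm2sub_eq (n : ℕ) (hn : 4 ≤ n) : Fm2sub n = (spJ n hn false).range := by
  rw [spJ_range, Fm2sub]
  congr 2
  ext i
  constructor
  · intro h
    have h : 2 ≤ i.1 := h
    exact ⟨⟨i.1 - 2, by have := i.2; simp; omega⟩, by simp only [spEmb, Fin.ext_iff]; omega⟩
  · rintro ⟨x, rfl⟩
    simp [spEmb]
end Free

open scoped Pointwise

/-- `splitOut ≅ Aut(F_2) × Aut(F_{n-2})`: if `ι` is the natural inclusion
`Aut(F_2) × Aut(F_{n-2}) → Aut(F_n)` (extending each pair of automorphisms over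
the decomposition `F_n = F_2 ∗ F_{n-2}`), then the induced map to
`Out(F_n) = Aut(F_n)/Inn(F_n)` is injective, with image exactly the subgroup
`splitOut` of outer automorphisms preserving the conjugacy classes of both
`F_2` and `F_{n-2}`. -/
theorem splitOut_iso (n : ℕ) (hn : 4 ≤ n)
    (ι : MulAut (FreeGroup (Fin 2)) × MulAut (FreeGroup (Fin (n - 2))) →*
      MulAut (FreeGroup (Fin n)))
    (hι1 : ∀ (p : MulAut (FreeGroup (Fin 2)) × MulAut (FreeGroup (Fin (n - 2))))
      (i : Fin 2), (ι p) (FreeGroup.of (⟨i.1, by omega⟩ : Fin n)) =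
        FreeGroup.map (fun j : Fin 2 => (⟨j.1, by omega⟩ : Fin n)) (p.1 (FreeGroup.of i)))
    (hι2 : ∀ (p : MulAut (FreeGroup (Fin 2)) × MulAut (FreeGroup (Fin (n - 2))))
      (i : Fin (n - 2)), (ι p) (FreeGroup.of (⟨i.1 + 2, by have := i.2; omega⟩ : Fin n)) =
        FreeGroup.map (fun j : Fin (n - 2) => (⟨j.1 + 2, by have := j.2; omega⟩ : Fin n))
          (p.2 (FreeGroup.of i))) :
    Function.Injective ((QuotientGroup.mk' (Inn (FreeGroup (Fin n)))).comp ι) ∧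
    (((QuotientGroup.mk' (Inn (FreeGroup (Fin n)))).comp ι).range : Set _) =
      {q : MulAut (FreeGroup (Fin n)) ⧸ Inn (FreeGroup (Fin n)) |
        ∃ φ : MulAut (FreeGroup (Fin n)),
          QuotientGroup.mk' (Inn (FreeGroup (Fin n))) φ = q ∧
          ConjInvariant φ (F2sub n) ∧ ConjInvariant φ (Fm2sub n)} := by
  have hbij := spJ_bij n hn
  have e1 : ∀ p x, ι p (spJ n hn true x) = spJ n hn true (p.1 x) := by
    intro p x
    have : (ι p).toMonoidHom.comp (spJ n hn true) = (spJ n hn true).comp p.1.toMonoidHom := by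
      ext i
      exact hι1 p i
    exact DFunLike.congr_fun this x
  have e2 : ∀ p x, ι p (spJ n hn false x) = spJ n hn false (p.2 x) := by
    intro p x
    have : (ι p).toMonoidHom.comp (spJ n hn false) = (spJ n hn false).comp p.2.toMonoidHom := by
      ext i
      exact hι2 p i
    exact DFunLike.congr_fun this x
  have s1 : ∀ p, ι p • (spJ n hn true).range = (spJ n hn true).range := by
    intro p
    ext y
    constructor
    · rintro ⟨_, ⟨x, rfl⟩, rfl⟩
      exact ⟨p.1 x, (e1 p x).symm⟩
    · rintro ⟨x, rfl⟩
      exact ⟨_, ⟨p.1⁻¹ x, rfl⟩, (e1 p _).trans (by rw [MulAut.apply_inv_self])⟩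
  have s2 : ∀ p, ι p • (spJ n hn false).range = (spJ n hn false).range := by
    intro p
    ext y
    constructor
    · rintro ⟨_, ⟨x, rfl⟩, rfl⟩
      exact ⟨p.2 x, (e2 p x).symm⟩
    · rintro ⟨x, rfl⟩
      exact ⟨_, ⟨p.2⁻¹ x, rfl⟩, (e2 p _).trans (by rw [MulAut.apply_inv_self])⟩
  have : Nontrivial (FreeGroup (spT n true)) :=
    haveI : Nonempty (spT n true) := ⟨⟨0, by simp⟩⟩
    inferInstance
  have : Nontrivial (FreeGroup (spT n false)) :=
    haveI : Nonempty (spT n false) := ⟨⟨0, by simp; omega⟩⟩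
    inferInstance
  constructor
  · rw [injective_iff_map_eq_one]
    intro p hp
    have hp' : ι p ∈ Inn (FreeGroup (Fin n)) := (QuotientGroup.eq_one_iff _).mp hp
    obtain ⟨c, hc⟩ := hp'
    have c1 := sp_P_malnormal (spJ n hn) hbij true c (by rw [hc, s1])
    have c2 := sp_P_malnormal (spJ n hn) hbij false c (by rw [hc, s2])
    have c0 := sp_P_inter (spJ n hn) hbij c c1 c2
    rw [c0, map_one] at hc
    refine Prod.ext (MulEquiv.ext fun x => ?_) (MulEquiv.ext fun x => ?_)
    · apply spJ_inj n hn true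
      rw [← e1, ← hc]; rfl
    · apply spJ_inj n hn false
      rw [← e2, ← hc]; rfl
  · ext q
    constructor
    · rintro ⟨p, rfl⟩
      refine ⟨ι p, rfl, ⟨1, ?_⟩, ⟨1, ?_⟩⟩
      · rw [F2sub_eq n hn]
        refine (s1 p).trans ?_
        rw [map_one]
        exact (one_smul (MulAut (FreeGroup (Fin n))) _).symm
      · rw [Fm2sub_eq n hn]
        refine (s2 p).trans ?_
        rw [map_one]
        exact (one_smul (MulAut (FreeGroup (Fin n))) _).symm
    · rintro ⟨φ, rfl, h1, h2⟩
      rw [F2sub_eq n hn] at h1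
      rw [Fm2sub_eq n hn] at h2
      obtain ⟨c, hc⟩ := sp_fix (spJ n hn) hbij φ h1 h2
      obtain ⟨α, hα⟩ := sp_restrict _ (spJ_inj n hn true) _ (hc true)
      obtain ⟨β, hβ⟩ := sp_restrict _ (spJ_inj n hn false) _ (hc false)
      refine ⟨(α, β), ?_⟩
      have key : ι (α, β) = MulAut.conj c * φ := by
        apply MulEquiv.toMonoidHom_injective
        ext i
        rcases spEmb_cases n hn i with ⟨x, rfl⟩ | ⟨x, rfl⟩
        · have hx : FreeGroup.of (spEmb n hn true x) = spJ n hn true (FreeGroup.of x) := by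
            simp [spJ]
          rw [hx]
          exact (e1 (α, β) _).trans (hα _)
        · have hx : FreeGroup.of (spEmb n hn false x) = spJ n hn false (FreeGroup.of x) := by
            simp [spJ]
          rw [hx]
          exact (e2 (α, β) _).trans (hβ _)
      have hin : QuotientGroup.mk' (Inn (FreeGroup (Fin n))) (MulAut.conj c) = 1 :=
        (QuotientGroup.eq_one_iff _).mpr ⟨c, rfl⟩
      rw [MonoidHom.comp_apply, key, map_mul, hin, one_mul]
end
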